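/- arXiv:1701.07915 — 3 statements merged into one kernel-verified Lean document; each statement's English description precedes it below -/
import Mathlib

section
/- For non-negative integers m and n, the generating function for overpartitions fitting inside an m×n rectangle (largest part ≤ m, number of parts ≤ n), where q tracks the weight and t tracks the number of overlined parts, equals ∑_{k=0}^{min(m,n)} t^k q^{k(k+1)/2} (q;q)_{m+n-k} / ((q;q)_k (q;q)_{m-k} (q;q)_{n-k}), where (q;q)_j = ∏_{i=1}^{j}(1-q^i). Here an overpartition is a partition in which the last occurrence of each distinct part size may be overlined. -/
open Finset Polynomial

/-- `overp m n k N` is the number of overpartitions of `N` with `k` overlined parts,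
largest part `≤ m`, and at most `n` parts. An overpartition is a partition together
with a subset of its (distinct) part sizes which are overlined. -/
noncomputable def overp (m n k N : ℕ) : ℕ :=
  Nat.card {p : Nat.Partition N × Finset ℕ //
    (∀ i ∈ p.1.parts, i ≤ m) ∧ Multiset.card p.1.parts ≤ n ∧
    p.2 ⊆ p.1.parts.toFinset ∧ p.2.card = k}

/-- The over-(q,t)-binomial coefficient for the `m × n` rectangle, evaluated at
elements `q t` of a commutative ring. -/
noncomputable def Oqt {R : Type*} [CommRing R] (q t : R) (m n : ℕ) : R :=
  ∑ N ∈ range (m * n + 1), ∑ k ∈ range (n + 1), (overp m n k N : R) * t ^ k * q ^ N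

/-- Explicit recursive finset of overpartitions in the box. -/
def OS : ℕ → ℕ → Finset (Multiset ℕ × Finset ℕ)
  | 0, _ => {(0, ∅)}
  | _ + 1, 0 => {(0, ∅)}
  | m + 1, n + 1 => OS m (n + 1) ∪
      ((OS (m + 1) n).image (fun p => ((m + 1) ::ₘ p.1, p.2)) ∪
       (OS m n).image (fun p => ((m + 1) ::ₘ p.1, insert (m + 1) p.2)))

theorem mem_OS (m n : ℕ) (s : Multiset ℕ) (T : Finset ℕ) :
    (s, T) ∈ OS m n ↔ (∀ i ∈ s, 0 < i ∧ i ≤ m) ∧ Multiset.card s ≤ n ∧ (∀ i ∈ T, i ∈ s) := by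
  induction m, n using OS.induct generalizing s T with
  | case1 n =>
    simp only [OS, mem_singleton, Prod.mk.injEq]
    constructor
    · rintro ⟨rfl, rfl⟩; simp
    · rintro ⟨h1, h2, h3⟩
      have : s = 0 := Multiset.eq_zero_of_forall_notMem (fun i hi => by have := h1 i hi; omega)
      subst this
      refine ⟨rfl, Finset.eq_empty_of_forall_notMem (fun i hi => by simpa using h3 i hi)⟩
  | case2 m =>
    simp only [OS, mem_singleton, Prod.mk.injEq]
    constructor
    · rintro ⟨rfl, rfl⟩; simp
    · rintro ⟨h1, h2, h3⟩
      have : s = 0 := by simpa using h2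
      subst this
      refine ⟨rfl, Finset.eq_empty_of_forall_notMem (fun i hi => by simpa using h3 i hi)⟩
  | case3 m n ih1 ih2 ih3 =>
    simp only [OS, mem_union, mem_image, Prod.exists, Prod.mk.injEq, ih1, ih2, ih3]
    constructor
    · rintro (⟨h1, h2, h3⟩ | ⟨s', T', ⟨h1, h2, h3⟩, rfl, rfl⟩ | ⟨s', T', ⟨h1, h2, h3⟩, rfl, rfl⟩)
      · exact ⟨fun i hi => ⟨(h1 i hi).1, by have := (h1 i hi).2; omega⟩, h2, h3⟩
      · refine ⟨?_, by simpa using h2, fun i hi => by simp [h3 i hi]⟩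
        intro i hi
        rcases Multiset.mem_cons.1 hi with rfl | hi
        · omega
        · exact h1 i hi
      · refine ⟨?_, by simpa using h2, ?_⟩
        · intro i hi
          rcases Multiset.mem_cons.1 hi with rfl | hi
          · omega
          · have := h1 i hi; omega
        · intro i hi
          rcases Finset.mem_insert.1 hi with rfl | hi
          · simp
          · simp [h3 i hi]
    · rintro ⟨h1, h2, h3⟩
      by_cases hm : m + 1 ∈ s
      · obtain ⟨s', rfl⟩ := Multiset.exists_cons_of_mem hm
        right
        have h2' : Multiset.card s' ≤ n := by simpa using h2
        by_cases hc : m + 1 ∈ T ∧ m + 1 ∉ s'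
        · right
          refine ⟨s', T.erase (m + 1), ⟨?_, h2', ?_⟩, rfl, Finset.insert_erase hc.1⟩
          · intro i hi
            have := h1 i (Multiset.mem_cons_of_mem hi)
            have : i ≠ m + 1 := by rintro rfl; exact hc.2 hi
            omega
          · intro i hi
            rw [Finset.mem_erase] at hi
            exact (Multiset.mem_cons.1 (h3 i hi.2)).resolve_left hi.1
        · left
          refine ⟨s', T, ⟨fun i hi => h1 i (Multiset.mem_cons_of_mem hi), h2', ?_⟩, rfl, rfl⟩
          intro i hi
          rcases Multiset.mem_cons.1 (h3 i hi) with rfl | h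
          · by_contra h; exact hc ⟨hi, h⟩
          · exact h
      · left
        refine ⟨fun i hi => ?_, h2, h3⟩
        have := h1 i hi
        have : i ≠ m + 1 := by rintro rfl; exact hm hi
        omega

/-- Generating function of `OS`. -/
def OG {F : Type*} [Field F] (q t : F) (m n : ℕ) : F :=
  ∑ p ∈ OS m n, t ^ p.2.card * q ^ p.1.sum

theorem OG_zero_left {F : Type*} [Field F] (q t : F) (n : ℕ) : OG q t 0 n = 1 := by
  simp [OG, OS]

theorem OG_zero_right {F : Type*} [Field F] (q t : F) (m : ℕ) : OG q t m 0 = 1 := by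
  cases m <;> simp [OG, OS]

theorem OG_succ {F : Type*} [Field F] (q t : F) (m n : ℕ) :
    OG q t (m + 1) (n + 1) = OG q t m (n + 1) + q ^ (m + 1) * OG q t (m + 1) n
      + t * q ^ (m + 1) * OG q t m n := by
  have hnot : ∀ {k s T}, (s, T) ∈ OS m k → m + 1 ∉ s := by
    intro k s T h hm
    have := ((mem_OS _ _ _ _).1 h).1 _ hm
    omega
  have hnot2 : ∀ {k s T}, (s, T) ∈ OS m k → m + 1 ∉ T := by
    intro k s T h hm
    exact hnot h (((mem_OS _ _ _ _).1 h).2.2 _ hm)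
  unfold OG
  rw [OS, Finset.sum_union, Finset.sum_union, Finset.sum_image, Finset.sum_image,
    Finset.mul_sum, Finset.mul_sum, ← add_assoc]
  · congr 1
    · congr 1
      apply Finset.sum_congr rfl
      intro p _
      simp only [Multiset.sum_cons]
      ring
    · apply Finset.sum_congr rfl
      rintro ⟨s, T⟩ hp
      simp only [Multiset.sum_cons, Finset.card_insert_of_notMem (hnot2 hp)]
      ring
  · rintro ⟨s, T⟩ hp ⟨s', T'⟩ hp' h
    simp only [Prod.mk.injEq, Multiset.cons_inj_right] at h
    rw [h.1, ← Finset.erase_insert (hnot2 hp), h.2, Finset.erase_insert (hnot2 hp')]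
  · rintro ⟨s, T⟩ hp ⟨s', T'⟩ hp' h
    simp only [Prod.mk.injEq, Multiset.cons_inj_right] at h
    rw [h.1, h.2]
  · rw [Finset.disjoint_left]
    rintro ⟨s, T⟩ h1 h2
    simp only [mem_image, Prod.exists, Prod.mk.injEq] at h1 h2
    obtain ⟨s1, T1, h1, rfl, rfl⟩ := h1
    obtain ⟨s2, T2, h2, h3, h4⟩ := h2
    rw [Multiset.cons_inj_right] at h3
    subst h3
    refine hnot h2 (((mem_OS _ _ _ _).1 h1).2.2 _ ?_)
    rw [← h4]; simp
  · rw [Finset.disjoint_left]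
    rintro ⟨s, T⟩ h1 h2
    apply hnot h1
    simp only [mem_union, mem_image, Prod.exists, Prod.mk.injEq] at h2
    rcases h2 with ⟨s1, T1, h2, rfl, rfl⟩ | ⟨s1, T1, h2, rfl, rfl⟩ <;> simp

theorem overp_eq (m n k N : ℕ) :
    overp m n k N = ((OS m n).filter (fun p => p.1.sum = N ∧ p.2.card = k)).card := by
  unfold overp
  rw [← Nat.card_eq_finsetCard]
  refine Nat.card_congr
    { toFun := fun p => ⟨(p.1.1.parts, p.1.2), ?_⟩
      invFun := fun p => ⟨(⟨p.1.1, ?_, ?_⟩, p.1.2), ?_⟩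
      left_inv := fun p => rfl
      right_inv := fun p => rfl }
  · obtain ⟨⟨P, T⟩, h1, h2, h3, h4⟩ := p
    rw [mem_filter, mem_OS]
    exact ⟨⟨fun i hi => ⟨P.parts_pos hi, h1 i hi⟩, h2,
      fun i hi => Multiset.mem_toFinset.1 (h3 hi)⟩, P.parts_sum, h4⟩
  · intro i hi
    obtain ⟨⟨s, T⟩, hp⟩ := p
    rw [mem_filter, mem_OS] at hp
    exact (hp.1.1 i hi).1
  · obtain ⟨⟨s, T⟩, hp⟩ := p
    rw [mem_filter, mem_OS] at hp
    exact hp.2.1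
  · obtain ⟨⟨s, T⟩, hp⟩ := p
    rw [mem_filter, mem_OS] at hp
    exact ⟨fun i hi => (hp.1.1 i hi).2, hp.1.2.1,
      fun i hi => Multiset.mem_toFinset.2 (hp.1.2.2 i hi), hp.2.2⟩

theorem Oqt_eq {F : Type*} [Field F] (q t : F) (m n : ℕ) : Oqt q t m n = OG q t m n := by
  unfold Oqt OG
  have hmaps : ∀ p ∈ OS m n, (p.1.sum, p.2.card) ∈ range (m * n + 1) ×ˢ range (n + 1) := by
    rintro ⟨s, T⟩ hp
    obtain ⟨h1, h2, h3⟩ := (mem_OS _ _ _ _).1 hp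
    simp only [mem_product, mem_range, Nat.lt_succ_iff]
    constructor
    · calc s.sum ≤ Multiset.card s • m := Multiset.sum_le_card_nsmul _ _ (fun i hi => (h1 i hi).2)
        _ ≤ m * n := by rw [smul_eq_mul, mul_comm]; gcongr
    · calc T.card ≤ s.toFinset.card := Finset.card_le_card (fun i hi => by simpa using h3 i hi)
        _ ≤ Multiset.card s := Multiset.toFinset_card_le s
        _ ≤ n := h2
  rw [← Finset.sum_fiberwise_of_maps_to hmaps, Finset.sum_product]
  apply Finset.sum_congr rfl; intro N _
  apply Finset.sum_congr rfl; intro k _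
  rw [overp_eq]
  simp only [Prod.mk.injEq]
  rw [Finset.sum_congr rfl (g := fun _ => t ^ k * q ^ N), Finset.sum_const, nsmul_eq_mul, mul_assoc]
  intro p hp
  rw [Finset.mem_filter] at hp
  rw [hp.2.1, hp.2.2]

/-- q-Pochhammer. -/
def QP {F : Type*} [Field F] (q : F) (j : ℕ) : F := ∏ i ∈ range j, (1 - q ^ (i + 1))

theorem QP_succ {F : Type*} [Field F] (q : F) (j : ℕ) :
    QP q (j + 1) = QP q j * (1 - q ^ (j + 1)) := Finset.prod_range_succ _ _

theorem QP_zero {F : Type*} [Field F] (q : F) : QP q 0 = 1 := by simp [QP]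

theorem QP_ne {F : Type*} [Field F] (q : F) (M : ℕ)
    (hq : ∀ i : ℕ, 1 ≤ i → i ≤ M → q ^ i ≠ 1) (j : ℕ) (hj : j ≤ M) : QP q j ≠ 0 := by
  rw [QP, Finset.prod_ne_zero_iff]
  intro i hi
  rw [mem_range] at hi
  rw [sub_ne_zero]
  exact (hq _ (by omega) (by omega)).symm

/-- Coefficient of `t ^ k`. -/
noncomputable def QA {F : Type*} [Field F] (q : F) (m n k : ℕ) : F :=
  if k ≤ m ∧ k ≤ n then q ^ (k * (k + 1) / 2) *
    (QP q (m + n - k) / (QP q k * QP q (m - k) * QP q (n - k))) else 0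

theorem tri_succ (k : ℕ) : (k + 1) * (k + 1 + 1) / 2 = k * (k + 1) / 2 + (k + 1) := by
  rw [show (k + 1) * (k + 1 + 1) = k * (k + 1) + (k + 1) * 2 by ring]
  exact Nat.add_mul_div_right _ _ (by norm_num)

theorem QA_add {F : Type*} [Field F] (q : F) (a b k : ℕ) : QA q (a + k) (b + k) k =
    q ^ (k * (k + 1) / 2) * (QP q (a + b + k) / (QP q k * QP q a * QP q b)) := by
  rw [QA, if_pos (by omega)]
  rw [show a + k + (b + k) - k = a + b + k by omega, Nat.add_sub_cancel, Nat.add_sub_cancel]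

theorem QA_of_lt_left {F : Type*} [Field F] (q : F) {m n k : ℕ} (h : m < k) : QA q m n k = 0 := by
  rw [QA, if_neg (by omega)]

theorem QA_of_lt_right {F : Type*} [Field F] (q : F) {m n k : ℕ} (h : n < k) :
    QA q m n k = 0 := by
  rw [QA, if_neg (by omega)]

theorem QA_succ_zero {F : Type*} [Field F] (q : F) (m n : ℕ)
    (hq : ∀ i : ℕ, 1 ≤ i → i ≤ m + n + 2 → q ^ i ≠ 1) :
    QA q (m + 1) (n + 1) 0 = QA q m (n + 1) 0 + q ^ (m + 1) * QA q (m + 1) n 0 := by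
  have e1 := QA_add q (m + 1) (n + 1) 0
  have e2 := QA_add q m (n + 1) 0
  have e3 := QA_add q (m + 1) n 0
  simp only [Nat.add_zero] at e1 e2 e3
  rw [e1, e2, e3]
  have hm := QP_ne q _ hq (m + 1) (by omega)
  have hn := QP_ne q _ hq (n + 1) (by omega)
  rw [show m + 1 + (n + 1) = (m + n + 1) + 1 by ring, show m + (n + 1) = m + n + 1 by ring,
    show m + 1 + n = m + n + 1 by ring, QP_succ q (m + n + 1)]
  rw [QP_succ] at hm hn
  rw [QP_succ q m, QP_succ q n]
  have hm1 := left_ne_zero_of_mul hm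
  have hm2 := right_ne_zero_of_mul hm
  have hn1 := left_ne_zero_of_mul hn
  have hn2 := right_ne_zero_of_mul hn
  rw [QP_zero]
  field_simp
  ring

theorem QA_succ {F : Type*} [Field F] (q : F) (m n k : ℕ)
    (hq : ∀ i : ℕ, 1 ≤ i → i ≤ m + n + 2 → q ^ i ≠ 1) :
    QA q (m + 1) (n + 1) (k + 1) = QA q m (n + 1) (k + 1) + q ^ (m + 1) * QA q (m + 1) n (k + 1)
      + q ^ (m + 1) * QA q m n k := by
  by_cases hkm : m < k
  · rw [QA_of_lt_left q (by omega), QA_of_lt_left q (by omega), QA_of_lt_left q (by omega),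
      QA_of_lt_left q (by omega)]; simp
  by_cases hkn : n < k
  · rw [QA_of_lt_right q (by omega), QA_of_lt_right q (by omega), QA_of_lt_right q (by omega),
      QA_of_lt_right q (by omega)]; simp
  obtain ⟨a, rfl⟩ := Nat.exists_eq_add_of_le' (not_lt.1 hkm)
  obtain ⟨b, rfl⟩ := Nat.exists_eq_add_of_le' (not_lt.1 hkn)
  have ha := QP_ne q _ hq a (by omega)
  have hb := QP_ne q _ hq b (by omega)
  have hk := QP_ne q _ hq (k + 1) (by omega)
  have e1 := QA_add q a b (k + 1)
  have e4 := QA_add q a b k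
  -- absorb boundary cases
  have e2 : QA q (a + k) (b + k + 1) (k + 1) = q ^ (k * (k + 1) / 2 + (k + 1)) *
      (QP q (a + b + k) * (1 - q ^ a) / (QP q (k + 1) * QP q a * QP q b)) := by
    rcases a with _ | a
    · rw [QA_of_lt_left q (by omega)]; simp
    · have := QA_add q a b (k + 1)
      rw [show a + 1 + k = a + (k + 1) by ring, show b + k + 1 = b + (k + 1) by ring, this,
        tri_succ, QP_succ q a, show a + 1 + b + k = a + b + (k + 1) by ring]
      rw [QP_succ] at ha
      have ha1 := left_ne_zero_of_mul ha
      have ha2 := right_ne_zero_of_mul ha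
      field_simp
  have e3 : QA q (a + k + 1) (b + k) (k + 1) = q ^ (k * (k + 1) / 2 + (k + 1)) *
      (QP q (a + b + k) * (1 - q ^ b) / (QP q (k + 1) * QP q a * QP q b)) := by
    rcases b with _ | b
    · rw [QA_of_lt_right q (by omega)]; simp
    · have := QA_add q a b (k + 1)
      rw [show b + 1 + k = b + (k + 1) by ring, show a + k + 1 = a + (k + 1) by ring, this,
        tri_succ, QP_succ q b, show a + (b + 1) + k = a + b + (k + 1) by ring]
      rw [QP_succ] at hb
      have hb1 := left_ne_zero_of_mul hb
      have hb2 := right_ne_zero_of_mul hb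
      field_simp
  rw [e2, e3, e4, show a + k + 1 = a + (k + 1) by ring, show b + k + 1 = b + (k + 1) by ring, e1,
    tri_succ, ← add_assoc (a + b) k 1, QP_succ q (a + b + k)]
  rw [QP_succ] at hk ⊢
  have hk1 := left_ne_zero_of_mul hk
  have hk2 := right_ne_zero_of_mul hk
  field_simp
  ring

theorem QA_zero {F : Type*} [Field F] (q : F) (m n : ℕ) (h : m = 0 ∨ n = 0)
    (hq : ∀ i : ℕ, 1 ≤ i → i ≤ m + n → q ^ i ≠ 1) : QA q m n 0 = 1 := by
  have hm := QP_ne q _ hq m (by omega)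
  have hn := QP_ne q _ hq n (by omega)
  rcases h with rfl | rfl <;> simp [QA, QP_zero, hm, hn]

theorem OG_eq {F : Type*} [Field F] (q t : F) (m n K : ℕ) (hK : min m n < K)
    (hq : ∀ i : ℕ, 1 ≤ i → i ≤ m + n → q ^ i ≠ 1) :
    OG q t m n = ∑ k ∈ range K, t ^ k * QA q m n k := by
  induction m, n using OS.induct generalizing K with
  | case1 n =>
    obtain ⟨K, rfl⟩ := Nat.exists_eq_succ_of_ne_zero (show K ≠ 0 by omega)
    rw [Finset.sum_range_succ', Finset.sum_eq_zero, OG_zero_left, QA_zero q _ _ (by simp) hq]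
    · simp
    · intro k _; rw [QA_of_lt_left q (by omega), mul_zero]
  | case2 m =>
    obtain ⟨K, rfl⟩ := Nat.exists_eq_succ_of_ne_zero (show K ≠ 0 by omega)
    rw [Finset.sum_range_succ', Finset.sum_eq_zero, OG_zero_right, QA_zero q _ _ (by simp) hq]
    · simp
    · intro k _; rw [QA_of_lt_right q (by omega), mul_zero]
  | case3 m n ih1 ih2 ih3 =>
    obtain ⟨K, rfl⟩ := Nat.exists_eq_succ_of_ne_zero (show K ≠ 0 by omega)
    have hq' : ∀ i : ℕ, 1 ≤ i → i ≤ m + n + 2 → q ^ i ≠ 1 :=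
      fun i h1 h2 => hq i h1 (by omega)
    rw [OG_succ, ih1 (K + 1) (by omega) (fun i h1 h2 => hq i h1 (by omega)),
      ih2 (K + 1) (by omega) (fun i h1 h2 => hq i h1 (by omega)),
      ih3 K (by omega) (fun i h1 h2 => hq i h1 (by omega))]
    simp only [Nat.succ_eq_add_one, Finset.sum_range_succ' _ K]
    simp only [QA_succ q m n _ hq', QA_succ_zero q m n hq', mul_add, Finset.sum_add_distrib,
      Finset.mul_sum]
    have h1 : ∑ x ∈ range K, t ^ (x + 1) * (q ^ (m + 1) * QA q (m + 1) n (x + 1)) =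
      ∑ i ∈ range K, q ^ (m + 1) * (t ^ (i + 1) * QA q (m + 1) n (i + 1)) :=
      Finset.sum_congr rfl (fun _ _ => by ring)
    have h2 : ∑ x ∈ range K, t ^ (x + 1) * (q ^ (m + 1) * QA q m n x) =
      ∑ i ∈ range K, t * q ^ (m + 1) * (t ^ i * QA q m n i) :=
      Finset.sum_congr rfl (fun _ _ => by ring)
    rw [h1, h2]
    ring

theorem stmt0 {F : Type*} [Field F] (q t : F) (m n : ℕ)
    (hq : ∀ i : ℕ, 1 ≤ i → i ≤ m + n → q ^ i ≠ 1) :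
    Oqt q t m n = ∑ k ∈ range (min m n + 1), t ^ k * q ^ (k * (k + 1) / 2) *
      ((∏ i ∈ range (m + n - k), (1 - q ^ (i + 1))) /
        ((∏ i ∈ range k, (1 - q ^ (i + 1))) * (∏ i ∈ range (m - k), (1 - q ^ (i + 1))) *
          (∏ i ∈ range (n - k), (1 - q ^ (i + 1))))) := by
  rw [Oqt_eq, OG_eq q t m n (min m n + 1) (by omega) hq]
  apply Finset.sum_congr rfl
  intro k hk
  rw [mem_range] at hk
  rw [QA, if_pos (by omega), ← mul_assoc]
  rfl
end

section
/- For each nonnegative integer n: ∑_{k=0}^{n} (−1)^k O(n, k) equals 0 if n is odd, and equals ∑_{j=−n/2}^{n/2} (−1)^j q^{j^2} if n is even. Here O(n,k) is the over-(q,1)-binomial coefficient, i.e. the generating function (in q) for overpartitions fitting inside an (n−k)×k rectangle. -/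
open Finset Polynomial

/-- The over-(q,1)-binomial coefficient for overpartitions fitting inside an
(a-b) x b rectangle, as a polynomial in q. -/
noncomputable def Oq1 (a b : ℕ) : Polynomial ℤ :=
  ∑ N ∈ range ((a - b) * b + 1),
    Polynomial.C (∑ k ∈ range (b + 1), (overp (a - b) b k N : ℤ)) * Polynomial.X ^ N

namespace Over

/-- recursive form -/
noncomputable def f : ℕ → ℕ → ℤ[X]
  | 0, _ => 1
  | _ + 1, 0 => 1
  | m + 1, n + 1 => f m (n + 1) + X ^ (m + 1) * (f (m + 1) n + f m n)

lemma f_zero_left (n : ℕ) : f 0 n = 1 := by simp [f]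
lemma f_zero_right (m : ℕ) : f m 0 = 1 := by cases m <;> simp [f]
lemma f_A (m n : ℕ) : f (m + 1) (n + 1) = f m (n + 1) + X ^ (m + 1) * (f (m + 1) n + f m n) := by
  rw [f]

lemma f_B (m : ℕ) : ∀ n, f (m + 1) (n + 1) = f (m + 1) n + X ^ (n + 1) * (f m (n + 1) + f m n) := by
  induction m with
  | zero =>
    intro n
    induction n with
    | zero => simp [f]
    | succ n ih =>
      have h1 := f_A 0 n
      have h2 := f_A 0 (n + 1)
      simp only [f_zero_left] at *
      linear_combination h2 - h1 + X * ih
  | succ m ihm =>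
    intro n
    induction n with
    | zero =>
      have h1 := f_A m 0
      have h2 := f_A (m + 1) 0
      have h3 := ihm 0
      simp only [f_zero_right] at *
      linear_combination h2 + h3 - X * h1
    | succ n ih =>
      have a1 := f_A (m + 1) (n + 1)
      have a2 := f_A (m + 1) n
      have a3 := f_A m (n + 1)
      have a4 := f_A m n
      have b1 := ihm (n + 1)
      have b2 := ihm n
      linear_combination a1 + b1 + X ^ (m + 2) * ih + X ^ (m + 2) * b2 - a2 - X ^ (n + 2) * a3
        - X ^ (n + 2) * a4

lemma f_symm (m : ℕ) : ∀ n, f m n = f n m := by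
  induction m with
  | zero => intro n; rw [f_zero_left, f_zero_right]
  | succ m ihm =>
    intro n
    induction n with
    | zero => rw [f_zero_left, f_zero_right]
    | succ n ih => rw [f_A, f_B, ih, ihm, ihm]

noncomputable def T (N : ℕ) : ℤ[X] := ∑ p ∈ antidiagonal N, (-1) ^ p.1 * f p.1 p.2
noncomputable def P (N : ℕ) : ℤ[X] := ∑ p ∈ antidiagonal N, (-1) ^ p.1 * X ^ p.1 * f p.1 p.2

lemma sum_ends (h : ℕ → ℕ → ℤ[X]) (N : ℕ) :
    ∑ p ∈ antidiagonal (N + 2), h p.1 p.2 =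
      h 0 (N + 2) + h (N + 2) 0 + ∑ p ∈ antidiagonal N, h (p.1 + 1) (p.2 + 1) := by
  rw [Finset.Nat.sum_antidiagonal_succ, Finset.Nat.sum_antidiagonal_succ']
  ring

lemma sum_left (h : ℕ → ℕ → ℤ[X]) (N : ℕ) :
    ∑ p ∈ antidiagonal N, h (p.1 + 1) p.2 = ∑ p ∈ antidiagonal (N + 1), h p.1 p.2 - h 0 (N + 1) := by
  rw [Finset.Nat.sum_antidiagonal_succ]; ring

lemma sum_right (h : ℕ → ℕ → ℤ[X]) (N : ℕ) :
    ∑ p ∈ antidiagonal N, h p.1 (p.2 + 1) = ∑ p ∈ antidiagonal (N + 1), h p.1 p.2 - h (N + 1) 0 := by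
  rw [Finset.Nat.sum_antidiagonal_succ']; ring

lemma T_A (N : ℕ) : T (N + 2) = - T (N + 1) + P (N + 1) - X * P N := by
  have e := sum_ends (fun m n => (-1) ^ m * f m n) N
  have r := sum_right (fun m n => (-1) ^ m * f m n) N
  have l := sum_left (fun m n => (-1) ^ m * X ^ m * f m n) N
  have key : ∑ p ∈ antidiagonal N, (-1 : ℤ[X]) ^ (p.1 + 1) * f (p.1 + 1) (p.2 + 1) =
      - ∑ p ∈ antidiagonal N, (-1) ^ p.1 * f p.1 (p.2 + 1)
      + ∑ p ∈ antidiagonal N, (-1) ^ (p.1 + 1) * X ^ (p.1 + 1) * f (p.1 + 1) p.2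
      - X * ∑ p ∈ antidiagonal N, (-1) ^ p.1 * X ^ p.1 * f p.1 p.2 := by
    rw [Finset.mul_sum, ← Finset.sum_neg_distrib, ← Finset.sum_add_distrib,
      ← Finset.sum_sub_distrib]
    refine Finset.sum_congr rfl fun p _ => ?_
    rw [f_A]; ring
  simp only [f_zero_left, f_zero_right] at e r l
  unfold T P
  linear_combination e + key - r + l

lemma P_B (N : ℕ) : P (N + 2) = P (N + 1) - X ^ (N + 2) * (T (N + 1) + T N) := by
  have e := sum_ends (fun m n => (-1) ^ m * X ^ m * f m n) N
  have r := sum_right (fun m n => (-1) ^ m * f m n) N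
  have l := sum_left (fun m n => (-1) ^ m * X ^ m * f m n) N
  have key : ∑ p ∈ antidiagonal N, (-1 : ℤ[X]) ^ (p.1 + 1) * X ^ (p.1 + 1) * f (p.1 + 1) (p.2 + 1) =
      ∑ p ∈ antidiagonal N, (-1) ^ (p.1 + 1) * X ^ (p.1 + 1) * f (p.1 + 1) p.2
      - X ^ (N + 2) * ∑ p ∈ antidiagonal N, (-1) ^ p.1 * f p.1 (p.2 + 1)
      - X ^ (N + 2) * ∑ p ∈ antidiagonal N, (-1) ^ p.1 * f p.1 p.2 := by
    rw [Finset.mul_sum, Finset.mul_sum, ← Finset.sum_sub_distrib, ← Finset.sum_sub_distrib]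
    refine Finset.sum_congr rfl fun p hp => ?_
    rw [← mem_antidiagonal.1 hp, f_B]; ring
  simp only [f_zero_left, f_zero_right] at e r l
  unfold T P
  linear_combination e + key + l - X ^ (N + 2) * r

lemma T_swap (N : ℕ) : T N = ∑ p ∈ antidiagonal N, (-1) ^ p.2 * f p.1 p.2 := by
  unfold T
  rw [← Finset.Nat.sum_antidiagonal_swap]
  refine Finset.sum_congr rfl fun p _ => ?_
  simp [f_symm p.2 p.1]

lemma T_odd (r : ℕ) : T (2 * r + 1) = 0 := by
  have h : T (2 * r + 1) = - T (2 * r + 1) := by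
    conv_lhs => rw [T_swap]
    unfold T
    rw [← Finset.sum_neg_distrib]
    refine Finset.sum_congr rfl fun p hp => ?_
    have h1 := mem_antidiagonal.1 hp
    have h2 : (-1 : ℤ[X]) ^ p.1 * (-1) ^ p.2 = -1 := by
      rw [← pow_add, h1]; exact Odd.neg_one_pow ⟨r, rfl⟩
    have h3 : (-1 : ℤ[X]) ^ p.1 * (-1) ^ p.1 = 1 := by
      rw [← mul_pow]; simp
    linear_combination (-(-1) ^ p.2 * f p.1 p.2) * h3 + (-1) ^ p.1 * f p.1 p.2 * h2
  exact self_eq_neg.1 h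

lemma T_diff (r : ℕ) : T (2 * r + 2) - T (2 * r) = 2 * (-1) ^ (r + 1) * X ^ ((r + 1) ^ 2) := by
  induction r with
  | zero =>
    simp [T, f, Finset.Nat.antidiagonal_succ]
    ring
  | succ r ih =>
    have a1 := T_A (2 * r + 2)
    have a2 := T_A (2 * r + 1)
    have b1 := P_B (2 * r + 1)
    have b2 := P_B (2 * r)
    have o1 := T_odd r
    have o2 := T_odd (r + 1)
    simp only [mul_add, add_assoc, mul_one] at *
    norm_num at *
    rw [o1, o2] at *
    linear_combination a1 - a2 + b1 - X * b2 - X ^ (2 * r + 3) * ih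

lemma T_even (r : ℕ) : T (2 * r) = ∑ j ∈ Finset.Icc (-(r : ℤ)) r,
        (-1 : Polynomial ℤ) ^ j.natAbs * Polynomial.X ^ (j.natAbs ^ 2) := by
  induction r with
  | zero => simp [T, f]
  | succ r ih =>
    have h : Finset.Icc (-((r + 1 : ℕ) : ℤ)) ((r + 1 : ℕ) : ℤ) =
      insert (-((r + 1 : ℕ) : ℤ)) (insert ((r + 1 : ℕ) : ℤ) (Finset.Icc (-(r : ℤ)) r)) := by
      ext j; simp only [Finset.mem_insert, Finset.mem_Icc]; omega
    rw [h, Finset.sum_insert, Finset.sum_insert, ← ih]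
    · have := T_diff r
      rw [Int.natAbs_neg, Int.natAbs_natCast, mul_add, mul_one]
      linear_combination this
    · simp only [Finset.mem_Icc]; omega
    · simp only [Finset.mem_insert, Finset.mem_Icc]; omega

/-- multisets in the box -/
def W (m n : ℕ) : Finset (Multiset ℕ) :=
  (n • (Finset.Icc 1 m).val).powerset.toFinset.filter (fun M => Multiset.card M ≤ n)

lemma mem_W {m n : ℕ} {M : Multiset ℕ} :
    M ∈ W m n ↔ (∀ i ∈ M, 1 ≤ i ∧ i ≤ m) ∧ Multiset.card M ≤ n := by
  simp only [W, Finset.mem_filter, Multiset.mem_toFinset, Multiset.mem_powerset]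
  refine and_congr_left fun hc => ⟨fun h i hi => ?_, fun h => ?_⟩
  · have := Multiset.mem_of_mem_nsmul (Multiset.mem_of_le h hi)
    simpa using this
  · rw [Multiset.le_iff_count]
    intro i
    by_cases hi : i ∈ M
    · rw [Multiset.count_nsmul, Multiset.count_eq_one_of_mem (Finset.nodup _) (by simpa using h i hi)]
      have := Multiset.count_le_card i M
      omega
    · rw [Multiset.count_eq_zero_of_notMem hi]; exact Nat.zero_le _

noncomputable def w (M : Multiset ℕ) : ℤ[X] := 2 ^ M.toFinset.card * X ^ M.sum

lemma sum_W (m n : ℕ) : ∑ M ∈ W m n, w M = f m n := by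
  induction m generalizing n with
  | zero =>
    have : W 0 n = {0} := by
      ext M
      rw [mem_W, Finset.mem_singleton]
      constructor
      · rintro ⟨h, -⟩
        refine Multiset.eq_zero_of_forall_notMem fun i hi => ?_
        have := h i hi; omega
      · rintro rfl; simp
    simp [this, w, f]
  | succ m ihm =>
    induction n with
    | zero =>
      have : W (m + 1) 0 = {0} := by
        ext M
        rw [mem_W, Finset.mem_singleton]
        constructor
        · rintro ⟨-, h⟩
          simpa using h
        · rintro rfl; simp
      simp [this, w, f]
    | succ n ihn =>
      have hd : Disjoint (W m (n + 1)) ((W (m + 1) n).image (Multiset.cons (m + 1))) := by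
        rw [Finset.disjoint_left]
        intro M hM hM'
        obtain ⟨M', -, rfl⟩ := Finset.mem_image.1 hM'
        have := (mem_W.1 hM).1 (m + 1) (by simp)
        omega
      have hu : W (m + 1) (n + 1) = W m (n + 1) ∪ (W (m + 1) n).image (Multiset.cons (m + 1)) := by
        ext M
        rw [Finset.mem_union, Finset.mem_image]
        constructor
        · intro hM
          obtain ⟨h1, h2⟩ := mem_W.1 hM
          by_cases h : m + 1 ∈ M
          · right
            obtain ⟨M', rfl⟩ := Multiset.exists_cons_of_mem h
            refine ⟨M', mem_W.2 ⟨fun i hi => h1 i (Multiset.mem_cons_of_mem hi), ?_⟩, rfl⟩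
            rw [Multiset.card_cons] at h2; omega
          · left
            refine mem_W.2 ⟨fun i hi => ?_, h2⟩
            have := h1 i hi
            have : i ≠ m + 1 := fun e => h (e ▸ hi)
            omega
        · rintro (h | ⟨M', h, rfl⟩)
          · obtain ⟨h1, h2⟩ := mem_W.1 h
            exact mem_W.2 ⟨fun i hi => ⟨(h1 i hi).1, by have := h1 i hi; omega⟩, h2⟩
          · obtain ⟨h1, h2⟩ := mem_W.1 h
            refine mem_W.2 ⟨fun i hi => ?_, by rw [Multiset.card_cons]; omega⟩
            rcases Multiset.mem_cons.1 hi with rfl | hi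
            · omega
            · exact h1 i hi
      have hf : W m n = (W (m + 1) n).filter (fun M => m + 1 ∉ M) := by
        ext M
        rw [Finset.mem_filter, mem_W, mem_W]
        constructor
        · rintro ⟨h1, h2⟩
          refine ⟨⟨fun i hi => ?_, h2⟩, fun h => ?_⟩
          · have := h1 i hi; omega
          · have := h1 _ h; omega
        · rintro ⟨⟨h1, h2⟩, h3⟩
          refine ⟨fun i hi => ?_, h2⟩
          have := h1 i hi
          have : i ≠ m + 1 := fun e => h3 (e ▸ hi)
          omega
      rw [hu, Finset.sum_union hd, ihm, Finset.sum_image (by intro a _ b _ h; simpa using h),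
        f_A, ← ihn, ← ihm n, hf, Finset.sum_filter, ← Finset.sum_add_distrib, Finset.mul_sum]
      congr 1
      refine Finset.sum_congr rfl fun M _ => ?_
      by_cases h : m + 1 ∈ M
      · simp only [w, h, Multiset.toFinset_cons, Multiset.sum_cons, not_true, if_false]
        rw [Finset.insert_eq_of_mem (by simpa using h)]
        ring
      · simp only [w, h, Multiset.toFinset_cons, Multiset.sum_cons, not_false_iff, if_true]
        rw [Finset.card_insert_of_notMem (by simpa using h)]
        ring

lemma overp_eq (m n k N : ℕ) :
    overp m n k N = ∑ M ∈ (W m n).filter (fun M => M.sum = N), M.toFinset.card.choose k := by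
  have : ∑ M ∈ (W m n).filter (fun M => M.sum = N), M.toFinset.card.choose k =
      (((W m n).filter (fun M => M.sum = N)).sigma (fun M => powersetCard k M.toFinset)).card := by
    rw [Finset.card_sigma]; simp
  rw [this, overp, ← Nat.card_eq_finsetCard]
  refine Nat.card_congr
    { toFun := fun p => ⟨⟨p.1.1.parts, p.1.2⟩, ?_⟩
      invFun := fun s => ⟨(⟨s.1.1, ?_, ?_⟩, s.1.2), ?_⟩
      left_inv := ?_
      right_inv := ?_ }
  · obtain ⟨⟨p, s⟩, h1, h2, h3, h4⟩ := p
    rw [Finset.mem_sigma, Finset.mem_filter, mem_W, Finset.mem_powersetCard]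
    exact ⟨⟨⟨fun i hi => ⟨p.parts_pos hi, h1 i hi⟩, h2⟩, p.parts_sum⟩, h3, h4⟩
  · intro i hi
    have h := s.2
    rw [Finset.mem_sigma, Finset.mem_filter, mem_W] at h
    exact (h.1.1.1 i hi).1
  · have h := s.2
    rw [Finset.mem_sigma, Finset.mem_filter] at h
    exact h.1.2
  · have h := s.2
    rw [Finset.mem_sigma, Finset.mem_filter, mem_W, Finset.mem_powersetCard] at h
    exact ⟨fun i hi => (h.1.1.1 i hi).2, h.1.1.2, h.2.1, h.2.2⟩
  · intro p; rfl
  · intro s; rfl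

lemma Oq1_eq (a b : ℕ) : Oq1 a b = f (a - b) b := by
  rw [← sum_W, Oq1]
  have hmap : ∀ M ∈ W (a - b) b, M.sum ∈ range ((a - b) * b + 1) := by
    intro M hM
    obtain ⟨h1, h2⟩ := mem_W.1 hM
    have := Multiset.sum_le_card_nsmul M (a - b) (fun i hi => (h1 i hi).2)
    rw [Finset.mem_range, Nat.lt_succ_iff]
    refine this.trans ?_
    rw [smul_eq_mul, mul_comm]
    exact Nat.mul_le_mul_left _ h2
  rw [← Finset.sum_fiberwise_of_maps_to hmap]
  refine Finset.sum_congr rfl fun N _ => ?_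
  have : ∑ k ∈ range (b + 1), (overp (a - b) b k N : ℤ) =
      ∑ M ∈ (W (a - b) b).filter (fun M => M.sum = N), 2 ^ M.toFinset.card := by
    simp only [overp_eq, Nat.cast_sum]
    rw [Finset.sum_comm]
    refine Finset.sum_congr rfl fun M hM => ?_
    have hc := (mem_W.1 (Finset.mem_filter.1 hM).1).2
    have hc' := (Multiset.toFinset_card_le M).trans hc
    rw [← Nat.cast_sum]
    norm_cast
    rw [← Nat.sum_range_choose]
    symm
    refine Finset.sum_subset (by intro x; simp; omega) ?_
    intro x _ hx
    exact Nat.choose_eq_zero_of_lt (by simpa using hx)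
  rw [this, map_sum, Finset.sum_mul]
  refine Finset.sum_congr rfl fun M hM => ?_
  rw [w, (Finset.mem_filter.1 hM).2]
  simp

end Over

theorem stmt9 (n : ℕ) :
    ∑ k ∈ range (n + 1), (-1 : Polynomial ℤ) ^ k * Oq1 n k =
      if Odd n then 0
      else ∑ j ∈ Finset.Icc (-((n : ℤ) / 2)) ((n : ℤ) / 2),
        (-1 : Polynomial ℤ) ^ j.natAbs * Polynomial.X ^ (j.natAbs ^ 2) := by
  have h : ∑ k ∈ range (n + 1), (-1 : Polynomial ℤ) ^ k * Oq1 n k = Over.T n := by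
    rw [Over.T, Finset.Nat.sum_antidiagonal_eq_sum_range_succ_mk]
    refine Finset.sum_congr rfl fun k _ => ?_
    rw [Over.Oq1_eq, Over.f_symm]
  rw [h]
  split_ifs with ho
  · obtain ⟨r, rfl⟩ := ho
    exact Over.T_odd r
  · obtain ⟨r, rfl⟩ := (Nat.not_odd_iff_even.1 ho).exists_two_nsmul
    rw [smul_eq_mul, Over.T_even]
    have : ((2 * r : ℕ) : ℤ) / 2 = r := by push_cast; omega
    rw [this]
end

section
/- For all 0 < k ≤ ℓ < n, the polynomial O(n,k)·O(n,ℓ) − O(n,k−1)·O(n,ℓ+1) has non-negative coefficients as a polynomial in q and t, where O(n,j) is the over-(q,t)-binomial coefficient for overpartitions fitting inside an (n−j)×j rectangle. -/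
open Finset Polynomial

/-- The over-(q,t)-binomial coefficient for overpartitions fitting inside an
(a-b) x b rectangle, as a polynomial in q (outer variable) and t (inner variable). -/
noncomputable def OqtP (a b : ℕ) : Polynomial (Polynomial ℤ) :=
  ∑ N ∈ range ((a - b) * b + 1), ∑ k ∈ range (b + 1),
    Polynomial.C (Polynomial.C (overp (a - b) b k N : ℤ) * Polynomial.X ^ k) * Polynomial.X ^ N

namespace OverLC

section Alg
variable {R : Type*} [CommRing R]

/-- shift of a sequence -/
def shf (u : ℕ → R) : ℕ → R
  | 0 => 0
  | j + 1 => u j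

/-- transfer sequences -/
def H (q t : R) (d : ℕ) : ℕ → ℕ → R
  | 0, i => if i < d then 0 else 1
  | w + 1, i => ∑ j ∈ range (i + 1), q ^ (j - d) * (H q t d w j + t * shf (H q t d w) j)

/-- the order relation on sequences -/
def Rel (S : Subsemiring R) (u v : ℕ → R) : Prop :=
  ∀ i j, i ≤ j → u j * v i - u i * v j ∈ S

lemma shf_mem {S : Subsemiring R} {u : ℕ → R} (hu : ∀ i, u i ∈ S) (i : ℕ) : shf u i ∈ S := by
  cases i with
  | zero => exact S.zero_mem
  | succ i => exact hu i

lemma H_mem {S : Subsemiring R} {q t : R} (hq : q ∈ S) (ht : t ∈ S) (d w i : ℕ) :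
    H q t d w i ∈ S := by
  induction w generalizing i with
  | zero =>
    simp only [H]; split_ifs
    · exact S.zero_mem
    · exact S.one_mem
  | succ w ih =>
    simp only [H]
    exact S.sum_mem fun j _ => S.mul_mem (S.pow_mem hq _)
      (S.add_mem (ih j) (S.mul_mem ht (shf_mem ih j)))

lemma H_zero_of_lt (q t : R) (d w i : ℕ) (h : i < d) : H q t d w i = 0 := by
  induction w generalizing i with
  | zero => simp [H, h]
  | succ w ih =>
    simp only [H]
    refine sum_eq_zero fun j hj => ?_
    have hj' : j < d := by have := mem_range.1 hj; omega
    rw [ih j hj']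
    cases j with
    | zero => simp [shf]
    | succ j => simp [shf, ih j (by omega)]

lemma H_shift (q t : R) (d w i : ℕ) : H q t d w (i + d) = H q t 0 w i := by
  induction w generalizing i with
  | zero => simp [H]
  | succ w ih =>
    simp only [H]
    rw [show i + d + 1 = d + (i + 1) by ring, sum_range_add]
    rw [sum_eq_zero, zero_add]
    · refine sum_congr rfl fun j _ => ?_
      rw [add_comm d j, ih, Nat.add_sub_cancel, Nat.sub_zero]
      congr 3
      cases j with
      | zero =>
        cases d with
        | zero => rfl
        | succ d => simp [shf, H_zero_of_lt]
      | succ j =>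
        rw [show j + 1 + d = (j + d) + 1 by ring]
        exact ih j
    · intro j hj
      have hj' : j < d := mem_range.1 hj
      rw [H_zero_of_lt _ _ _ _ _ hj']
      cases j with
      | zero => simp [shf]
      | succ j => simp [shf, H_zero_of_lt _ _ _ _ _ (show j < d by omega)]

lemma Rel.bidiag {S : Subsemiring R} {t : R} (ht : t ∈ S) {u v : ℕ → R} (h : Rel S u v) :
    Rel S (fun j => u j + t * shf u j) (fun j => v j + t * shf v j) := by
  intro i j hij
  rcases hij.eq_or_lt with rfl | hlt
  · simp
  · obtain ⟨j, rfl⟩ : ∃ j', j = j' + 1 := ⟨j - 1, by omega⟩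
    have h1 := h i (j+1) hij
    have h2 := h i j (by omega)
    cases i with
    | zero =>
      have := S.add_mem h1 (S.mul_mem ht h2)
      convert this using 1
      simp only [shf]; ring
    | succ i =>
      have h3 := h i (j+1) (by omega)
      have h4 := h i j (by omega)
      have := S.add_mem (S.add_mem h1 (S.mul_mem ht h2))
        (S.add_mem (S.mul_mem ht h3) (S.mul_mem (S.mul_mem ht ht) h4))
      convert this using 1
      simp only [shf]; ring

lemma Rel.sums {S : Subsemiring R} {u v : ℕ → R} (h : Rel S u v) :
    Rel S (fun i => ∑ j ∈ range (i + 1), u j) (fun i => ∑ j ∈ range (i + 1), v j) := by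
  intro i j hij
  obtain ⟨e, rfl⟩ := Nat.exists_eq_add_of_le hij
  have : (∑ r ∈ range e, ∑ s ∈ range (i+1),
      (u (i + 1 + r) * v s - u s * v (i + 1 + r))) ∈ S :=
    S.sum_mem fun r _ => S.sum_mem fun s hs => h _ _ (by have := mem_range.1 hs; omega)
  convert this using 1
  simp only [show i + e + 1 = (i + 1) + e by ring, sum_range_add _ (i+1) e]
  simp only [sum_sub_distrib, ← mul_sum, ← sum_mul]
  ring

lemma rel_H {S : Subsemiring R} {q t : R} (hq : q ∈ S) (ht : t ∈ S) (d B e : ℕ) :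
    Rel S (H q t d (B + e)) (H q t 0 B) := by
  induction B with
  | zero =>
    intro i j hij
    simp only [H, Nat.not_lt_zero, if_false, mul_one, zero_add]
    cases e with
    | zero =>
      simp only [H]
      split_ifs <;> first | omega | simp [S.zero_mem, S.one_mem]
    | succ e =>
      obtain ⟨f, rfl⟩ := Nat.exists_eq_add_of_le hij
      simp only [H]
      rw [show i + f + 1 = (i + 1) + f by ring, sum_range_add, add_sub_cancel_left]
      exact S.sum_mem fun j _ => S.mul_mem (S.pow_mem hq _)
        (S.add_mem (H_mem hq ht _ _ _) (S.mul_mem ht (shf_mem (H_mem hq ht _ _) _)))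
  | succ B ih =>
    have hb := ih.bidiag ht
    rw [show B + 1 + e = (B + e) + 1 by ring]
    refine Rel.sums (u := fun j => q ^ (j - d) * (H q t d (B+e) j + t * shf (H q t d (B+e)) j))
      (v := fun j => q ^ (j - 0) * (H q t 0 B j + t * shf (H q t 0 B) j)) ?_
    intro i j hij
    by_cases hi : i < d
    · have h0 : H q t d (B+e) i + t * shf (H q t d (B+e)) i = 0 := by
        rw [H_zero_of_lt _ _ _ _ _ hi]
        cases i with
        | zero => simp [shf]
        | succ i => simp [shf, H_zero_of_lt _ _ _ _ _ (show i < d by omega)]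
      have hm : ∀ d w j, q ^ (j - d) * (H q t d w j + t * shf (H q t d w) j) ∈ S := fun d w j =>
        S.mul_mem (S.pow_mem hq _)
        (S.add_mem (H_mem hq ht _ _ _) (S.mul_mem ht (shf_mem (H_mem hq ht _ _) j)))
      simp only [h0, mul_zero, zero_mul, sub_zero]
      exact S.mul_mem (hm d _ j) (hm 0 _ i)
    · obtain ⟨i, rfl⟩ := Nat.exists_eq_add_of_le (not_lt.1 hi)
      obtain ⟨f, rfl⟩ := Nat.exists_eq_add_of_le hij
      have := S.mul_mem (S.pow_mem hq (i + (d + i + f))) (hb _ _ hij)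
      convert this using 1
      simp only [Nat.sub_zero, show d + i + f - d = i + f by omega, show d + i - d = i by omega]
      ring

lemma claimA {S : Subsemiring R} {q t : R} (hq : q ∈ S) (ht : t ∈ S) {A B a c : ℕ}
    (hAB : B ≤ A) (hac : a ≤ c) :
    H q t 0 A (a + 1) * H q t 0 B c - H q t 0 A a * H q t 0 B (c + 1) ∈ S := by
  obtain ⟨d, rfl⟩ := Nat.exists_eq_add_of_le hac
  obtain ⟨e, rfl⟩ := Nat.exists_eq_add_of_le hAB
  have := rel_H hq ht d B e (a + d) (a + d + 1) (by omega)
  rwa [show a + d + 1 = (a + 1) + d by ring, H_shift, H_shift q t d (B + e) a,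
    show (a + 1) + d = a + d + 1 by ring] at this

lemma H_succ_succ (q t : R) (w h : ℕ) : H q t 0 (w + 1) (h + 1) =
    H q t 0 (w + 1) h + q ^ (h + 1) * (H q t 0 w (h + 1) + t * H q t 0 w h) := by
  simp only [H]
  rw [sum_range_succ _ (h + 1)]
  simp [shf]

lemma H_zero_right (q t : R) (w : ℕ) : H q t 0 w 0 = 1 := by
  induction w with
  | zero => simp [H]
  | succ w ih => simp [H, shf, ih]

lemma H_zero_left (q t : R) (h : ℕ) : H q t 0 0 h = 1 := by simp [H]

lemma H_succ_succ' (q t : R) (w h : ℕ) : H q t 0 (w + 1) (h + 1) =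
    H q t 0 w (h + 1) + q ^ (w + 1) * (H q t 0 (w + 1) h + t * H q t 0 w h) := by
  induction w generalizing h with
  | zero =>
    induction h with
    | zero => simp [H_succ_succ, H_zero_right, H_zero_left]
    | succ h ih =>
      have a1 := H_succ_succ q t 0 (h+1)
      have b := H_succ_succ q t 0 h
      simp only [H_zero_left] at *
      linear_combination a1 + ih - q * b
  | succ w ihw =>
    induction h with
    | zero =>
      have h1 := H_succ_succ q t (w+1) 0
      have h2 := H_succ_succ q t w 0
      have h3 := ihw 0
      simp only [H_zero_right] at *
      rw [h1, h3]
      linear_combination (-1) * h2 + h3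
    | succ h ih =>
      have a1 := H_succ_succ q t (w+1) (h+1)
      have a2 := ihw (h+1)
      have a3 := ihw h
      have b1 := H_succ_succ q t (w+1) h
      have b2 := H_succ_succ q t w h
      have b3 := H_succ_succ q t w (h+1)
      linear_combination a1 + ih + q^(h+1+1) * a2 + t*q^(h+1+1) * a3 - b3 - q^(w+1+1) * b1 
        - t * q^(w+1+1) * b2

lemma H_symm (q t : R) (w h : ℕ) : H q t 0 w h = H q t 0 h w := by
  induction w generalizing h with
  | zero => rw [H_zero_right, H_zero_left]
  | succ w ihw =>
    induction h with
    | zero => rw [H_zero_right, H_zero_left]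
    | succ h ih => rw [H_succ_succ, H_succ_succ', ih, ihw, ihw]

end Alg

/-- overpartitions with parts at most the first argument, at most the second number of parts -/
def B : ℕ → ℕ → Finset (Multiset ℕ × Finset ℕ)
  | 0, _ => {(0, ∅)}
  | _ + 1, 0 => {(0, ∅)}
  | h + 1, w + 1 => B h (w + 1) ∪ ((B (h + 1) w).image (fun p => ((h + 1) ::ₘ p.1, p.2)) ∪
      (B h w).image (fun p => ((h + 1) ::ₘ p.1, insert (h + 1) p.2)))
termination_by m n => m + n

lemma B_zero_left (w : ℕ) : B 0 w = {(0, ∅)} := by rw [B]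
lemma B_zero_right (h : ℕ) : B h 0 = {(0, ∅)} := by cases h <;> rw [B]

lemma mem_B (h w : ℕ) (s : Multiset ℕ) (S : Finset ℕ) : (s, S) ∈ B h w ↔
    (∀ i ∈ s, 0 < i ∧ i ≤ h) ∧ Multiset.card s ≤ w ∧ S ⊆ s.toFinset := by
  induction w generalizing h s S with
  | zero =>
    rw [B_zero_right]
    simp only [mem_singleton, Prod.mk.injEq, Nat.le_zero, Multiset.card_eq_zero]
    constructor
    · rintro ⟨rfl, rfl⟩; simp
    · rintro ⟨_, rfl, h⟩; simpa using h
  | succ w ihw =>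
    induction h generalizing s S with
    | zero =>
      rw [B_zero_left]
      simp only [mem_singleton, Prod.mk.injEq]
      constructor
      · rintro ⟨rfl, rfl⟩; simp
      · rintro ⟨h1, _, h⟩
        have : s = 0 := Multiset.eq_zero_of_forall_notMem fun i hi => by
          have := h1 i hi; omega
        subst this
        simpa using h
    | succ h ih =>
      rw [B, mem_union, mem_union, mem_image, mem_image, ih]
      constructor
      · rintro (⟨h1, h2, h3⟩ | ⟨⟨s', S'⟩, hp, he⟩ | ⟨⟨s', S'⟩, hp, he⟩)
        · exact ⟨fun i hi => ⟨(h1 i hi).1, (h1 i hi).2.trans (by omega)⟩, h2, h3⟩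
        · rw [ihw] at hp
          simp only [Prod.mk.injEq] at he
          obtain ⟨rfl, rfl⟩ := he
          obtain ⟨h1, h2, h3⟩ := hp
          refine ⟨?_, by simpa using h2, ?_⟩
          · intro i hi
            rcases Multiset.mem_cons.1 hi with rfl | hi
            · omega
            · exact h1 i hi
          · rw [Multiset.toFinset_cons]
            exact h3.trans (subset_insert _ _)
        · rw [ihw] at hp
          simp only [Prod.mk.injEq] at he
          obtain ⟨rfl, rfl⟩ := he
          obtain ⟨h1, h2, h3⟩ := hp
          refine ⟨?_, by simpa using h2, ?_⟩
          · intro i hi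
            rcases Multiset.mem_cons.1 hi with rfl | hi
            · omega
            · have := h1 i hi; omega
          · rw [Multiset.toFinset_cons]
            exact insert_subset_insert _ h3
      · rintro ⟨h1, h2, h3⟩
        by_cases hm : h + 1 ∈ s
        · right
          obtain ⟨s', rfl⟩ := Multiset.exists_cons_of_mem hm
          have hc : Multiset.card s' ≤ w := by simpa using h2
          rw [Multiset.toFinset_cons] at h3
          have h1' : ∀ i ∈ s', 0 < i ∧ i ≤ h + 1 := fun i hi => h1 i (Multiset.mem_cons_of_mem hi)
          by_cases hS : h + 1 ∈ S ∧ h + 1 ∉ s'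
          · right
            refine ⟨(s', S.erase (h + 1)), (ihw _ _ _).2 ⟨?_, hc, ?_⟩, ?_⟩
            · intro i hi
              have := h1' i hi
              have : i ≠ h + 1 := fun e => hS.2 (e ▸ hi)
              omega
            · exact subset_insert_iff.1 h3
            · simp [insert_erase hS.1]
          · left
            refine ⟨(s', S), (ihw _ _ _).2 ⟨h1', hc, ?_⟩, rfl⟩
            intro i hi
            rcases mem_insert.1 (h3 hi) with rfl | h'
            · by_contra hn
              exact hS ⟨hi, by simpa using hn⟩
            · exact h'
        · left
          refine ⟨fun i hi => ?_, h2, h3⟩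
          have := h1 i hi
          have : i ≠ h + 1 := fun e => hm (e ▸ hi)
          omega

/-- generating function -/
def GF {R : Type*} [CommRing R] (q t : R) (h w : ℕ) : R :=
  ∑ p ∈ B h w, t ^ p.2.card * q ^ p.1.sum

lemma GF_succ {R : Type*} [CommRing R] (q t : R) (h w : ℕ) : GF q t (h + 1) (w + 1) =
    GF q t h (w + 1) + q ^ (h + 1) * (GF q t (h + 1) w + t * GF q t h w) := by
  have hn : ∀ w' s S, (s, S) ∈ B h w' → h + 1 ∉ s ∧ h + 1 ∉ S := by
    intro w' s S hp
    rw [mem_B] at hp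
    have : h + 1 ∉ s := fun hi => by have := hp.1 _ hi; omega
    exact ⟨this, fun hi => this (by simpa using hp.2.2 hi)⟩
  simp only [GF]
  rw [B, sum_union, sum_union, sum_image, sum_image, mul_add, mul_sum, mul_sum, mul_sum]
  · congr 2
    · refine sum_congr rfl fun p _ => ?_
      rw [Multiset.sum_cons]; ring
    · refine sum_congr rfl fun p hp => ?_
      rw [Multiset.sum_cons, card_insert_of_notMem (hn w p.1 p.2 hp).2]; ring
  · rintro ⟨s, S⟩ hp ⟨s', S'⟩ hp' he
    simp only [Prod.mk.injEq, Multiset.cons_inj_right] at he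
    have h1 := (hn w s S hp).2
    have h2 := (hn w s' S' hp').2
    refine Prod.ext he.1 ?_
    have := congrArg (fun T => T.erase (h + 1)) he.2
    simpa [erase_insert h1, erase_insert h2] using this
  · rintro ⟨s, S⟩ hp ⟨s', S'⟩ hp' he
    simpa using he
  · rw [disjoint_left]
    rintro ⟨s, S⟩ h1 h2
    obtain ⟨⟨s1, S1⟩, hp1, he1⟩ := mem_image.1 h1
    obtain ⟨⟨s2, S2⟩, hp2, he2⟩ := mem_image.1 h2
    rw [← he2] at he1
    simp only [Prod.mk.injEq, Multiset.cons_inj_right] at he1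
    obtain ⟨rfl, rfl⟩ := he1
    have := ((mem_B _ _ _ _).1 hp1).2.2 (mem_insert_self _ _)
    exact (hn _ _ _ hp2).1 (by simpa using this)
  · rw [disjoint_left]
    rintro ⟨s, S⟩ h1 h2
    refine (hn _ _ _ h1).1 ?_
    rcases mem_union.1 h2 with h2 | h2 <;> obtain ⟨p, _, he⟩ := mem_image.1 h2 <;>
      simp only [Prod.mk.injEq] at he <;> rw [← he.1] <;> exact Multiset.mem_cons_self _ _

lemma GF_eq_H {R : Type*} [CommRing R] (q t : R) (h w : ℕ) : GF q t h w = H q t 0 w h := by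
  induction w generalizing h with
  | zero => simp [GF, B_zero_right, H_zero_left]
  | succ w ihw =>
    induction h with
    | zero => simp [GF, B_zero_left, H_zero_right]
    | succ h ih => rw [GF_succ, H_succ_succ, ih, ihw, ihw]

lemma overp_eq (m n k N : ℕ) :
    overp m n k N = #{p ∈ B m n | p.1.sum = N ∧ p.2.card = k} := by
  rw [overp, ← Fintype.card_coe, ← Nat.card_eq_fintype_card]
  refine Nat.card_congr
    { toFun := fun p => ⟨(p.1.1.parts, p.1.2), ?_⟩
      invFun := fun p => ⟨(⟨p.1.1, ?_, ?_⟩, p.1.2), ?_⟩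
      left_inv := fun p => rfl
      right_inv := fun p => rfl }
  · obtain ⟨⟨p, S⟩, h1, h2, h3, h4⟩ := p
    exact mem_filter.2 ⟨(mem_B _ _ _ _).2 ⟨fun i hi => ⟨p.parts_pos hi, h1 i hi⟩, h2, h3⟩,
      p.parts_sum, h4⟩
  · intro i hi
    exact (((mem_B _ _ _ _).1 (mem_filter.1 p.2).1).1 i hi).1
  · exact (mem_filter.1 p.2).2.1
  · have h := (mem_B _ _ _ _).1 (mem_filter.1 p.2).1
    exact ⟨fun i hi => (h.1 i hi).2, h.2.1, h.2.2, (mem_filter.1 p.2).2.2⟩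

lemma OqtP_eq (a b : ℕ) : OqtP a b =
    GF (Polynomial.X : Polynomial (Polynomial ℤ)) (C X) (a - b) b := by
  have key : ∀ p ∈ B (a - b) b, p.1.sum ∈ range ((a - b) * b + 1) ∧ p.2.card ∈ range (b + 1) := by
    rintro ⟨s, S⟩ hp
    rw [mem_B] at hp
    obtain ⟨h1, h2, h3⟩ := hp
    simp only [mem_range, Nat.lt_succ_iff]
    constructor
    · have := Multiset.sum_le_card_nsmul s (a - b) (fun i hi => (h1 i hi).2)
      rw [smul_eq_mul] at this
      rw [mul_comm]
      exact this.trans (Nat.mul_le_mul_right _ h2)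
    · exact (card_le_card h3).trans ((Multiset.toFinset_card_le s).trans h2)
  rw [GF, ← sum_fiberwise_of_maps_to (fun p hp => (key p hp).1), OqtP]
  refine sum_congr rfl fun N _ => ?_
  rw [← sum_fiberwise_of_maps_to (g := fun p => p.2.card) (t := range (b + 1))
    (fun p hp => (key p (mem_filter.1 hp).1).2)]
  refine sum_congr rfl fun k _ => ?_
  rw [filter_filter, overp_eq, sum_congr rfl (g := fun _ => (C X) ^ k * X ^ N), sum_const]
  · simp [mul_assoc]
  · intro p hp
    obtain ⟨_, h1, h2⟩ := mem_filter.1 hp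
    rw [h1, h2]

/-- nonnegative integer polynomials -/
def nnZ : Subsemiring (Polynomial ℤ) where
  carrier := {P | ∀ N, 0 ≤ P.coeff N}
  zero_mem' := by intro N; simp
  one_mem' := by intro N; rw [coeff_one]; split_ifs <;> simp
  add_mem' := by intro a b ha hb N; rw [coeff_add]; exact add_nonneg (ha N) (hb N)
  mul_mem' := by
    intro a b ha hb N
    rw [coeff_mul]; exact sum_nonneg fun p _ => mul_nonneg (ha _) (hb _)

/-- nonnegative two-variable polynomials -/
def nn : Subsemiring (Polynomial (Polynomial ℤ)) where
  carrier := {P | ∀ N, P.coeff N ∈ nnZ}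
  zero_mem' := by intro N; simp [nnZ.zero_mem]
  one_mem' := by intro N; rw [coeff_one]; split_ifs <;> simp [nnZ.zero_mem, nnZ.one_mem]
  add_mem' := by intro a b ha hb N; rw [coeff_add]; exact nnZ.add_mem (ha N) (hb N)
  mul_mem' := by
    intro a b ha hb N
    rw [coeff_mul]; exact nnZ.sum_mem fun p _ => nnZ.mul_mem (ha _) (hb _)

end OverLC

open OverLC in
theorem stmt14 (n k l : ℕ) (hk : 0 < k) (hkl : k ≤ l) (hln : l < n) :
    ∀ N K : ℕ,
      0 ≤ ((OqtP n k * OqtP n l - OqtP n (k - 1) * OqtP n (l + 1)).coeff N).coeff K := by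
  suffices h : OqtP n k * OqtP n l - OqtP n (k - 1) * OqtP n (l + 1) ∈ nn from
    fun N K => h N K
  have hq : (X : Polynomial (Polynomial ℤ)) ∈ nn := by
    intro N; rw [coeff_X]; split_ifs
    · exact nnZ.one_mem
    · exact nnZ.zero_mem
  have ht : (C X : Polynomial (Polynomial ℤ)) ∈ nn := by
    intro N; rw [coeff_C]; split_ifs
    · intro K; rw [coeff_X]; split_ifs <;> simp
    · exact nnZ.zero_mem
  simp only [OqtP_eq, GF_eq_H]
  obtain ⟨k, rfl⟩ : ∃ k', k = k' + 1 := ⟨k - 1, by omega⟩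
  obtain ⟨e, rfl⟩ : ∃ e, n = l + 1 + e := ⟨n - (l + 1), by omega⟩
  have s1 := claimA hq ht (A := l + 1) (B := k) (a := e) (c := l + e - k) (by omega) (by omega)
  have s2 := claimA hq ht (A := l + e - k) (B := e + 1) (a := k) (c := l) (by omega) (by omega)
  rw [show l + 1 + e - (k + 1) = l + e - k by omega, show l + 1 + e - l = e + 1 by omega,
    show k + 1 - 1 = k by omega, show l + 1 + e - k = l + e - k + 1 by omega,
    show l + 1 + e - (l + 1) = e by omega]
  rw [H_symm _ _ (l + e - k), H_symm _ _ (e + 1), H_symm _ _ (l + e - k), H_symm _ _ (e + 1)] at s2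
  have := nn.add_mem s1 s2
  convert this using 1
  ring
end
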